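/- arXiv:2306.08115 — 2 statements merged into one kernel-verified Lean document; each statement's English description precedes it below -/
import Mathlib

section
/- Let C be a category, F, G : C ⥤ Cat two functors, and α : F ⟶ G a natural transformation such that for every object c of C the component α.app c : F.obj c ⥤ G.obj c is an equivalence of categories. Then the induced functor Grothendieck.map α : Grothendieck F ⥤ Grothendieck G between the Grothendieck constructions is an equivalence of categories. -/
open CategoryTheory

/-- If `α : F ⟶ G` is a natural transformation of functors `C ⥤ Cat` whose
component at every object of `C` is an equivalence of categories, then the
induced functor `Grothendieck.map α : Grothendieck F ⥤ Grothendieck G` is an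
equivalence of categories. -/
theorem grothendieck_map_isEquivalence {C : Type*} [Category C]
    {F G : C ⥤ Cat} (α : F ⟶ G)
    (h : ∀ c : C, (α.app c).toFunctor.IsEquivalence) :
    (Grothendieck.map α).IsEquivalence := by
  have hiso : ∀ {c d : C} (f : c ⟶ d) (x : F.obj c),
      IsIso ((eqToHom (α.naturality f).symm).toNatTrans.app x) := by
    intro c d f x
    rw [Cat.Hom₂.eqToHom_toNatTrans, eqToHom_app]
    infer_instance
  refine { faithful := ⟨?_⟩, full := ⟨?_⟩, essSurj := ⟨?_⟩ }
  · rintro X Y ⟨fb, ff⟩ ⟨gb, gf⟩ hfg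
    have hb : fb = gb := congrArg Grothendieck.Hom.base hfg
    subst hb
    have hf := (Grothendieck.congr hfg).trans (Category.id_comp _)
    have := hiso fb X.fiber
    have h2 := (cancel_epi ((eqToHom (α.naturality fb).symm).toNatTrans.app X.fiber)).1 hf
    have := (α.app Y.base).toFunctor.map_injective h2
    exact congrArg (Grothendieck.Hom.mk fb) this
  · rintro X Y ⟨gbase, gfib⟩
    obtain ⟨gb, hgb⟩ : ∃ gb : X.base ⟶ Y.base, gb = gbase := ⟨gbase, rfl⟩
    subst hgb
    let gf : (G.map gb).toFunctor.obj ((α.app X.base).toFunctor.obj X.fiber) ⟶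
      (α.app Y.base).toFunctor.obj Y.fiber := gfib
    have hi := hiso gb X.fiber
    let u : (α.app Y.base).toFunctor.obj ((F.map gb).toFunctor.obj X.fiber) ⟶
      (α.app Y.base).toFunctor.obj Y.fiber := (@inv _ _ _ _ _ hi) ≫ gf
    obtain ⟨k, hk⟩ := (α.app Y.base).toFunctor.map_surjective u
    refine ⟨⟨gb, k⟩, ?_⟩
    refine Grothendieck.ext _ _ rfl ((Category.id_comp _).trans ?_)
    exact (congrArg (fun t => (eqToHom (α.naturality gb).symm).toNatTrans.app X.fiber ≫ t) hk).trans
      (@IsIso.hom_inv_id_assoc _ _ _ _ _ (hiso gb X.fiber) _ _)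
  · intro Y
    let e := (α.app Y.base).toFunctor.objObjPreimageIso Y.fiber
    refine ⟨⟨Y.base, (α.app Y.base).toFunctor.objPreimage Y.fiber⟩, ⟨?_⟩⟩
    refine Grothendieck.isoMk (Iso.refl Y.base) (eqToIso ?_ ≪≫ e)
    change (G.map (𝟙 Y.base)).toFunctor.obj _ = _
    rw [G.map_id]
    rfl
end

section
/- Let C be a small category and F : C ⥤ Cat a functor. Then the base-change functor along the projection Grothendieck.forget F : Grothendieck F ⥤ C, i.e., the pullback functor Over (Cat.of C) ⥤ Over (Cat.of (Grothendieck F)) in the category Cat of small categories (which has pullbacks), admits a right adjoint; in particular it preserves all small colimits that exist. -/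
open CategoryTheory CategoryTheory.Limits

universe u

namespace GrothExp

section Lift
variable {A : Type*} [Category A] {D : Type*} [Category D]

/-- If `L : A ⥤ Over B` becomes a left adjoint after forgetting to `D`, it is a left adjoint. -/
theorem isLeftAdjoint_of_comp_forget [HasBinaryProducts D] [HasEqualizers A] {B : D}
    (L : A ⥤ Over B) (h : (L ⋙ Over.forget B).IsLeftAdjoint) : L.IsLeftAdjoint := by
  let L' : A ⥤ Comonad.Coalgebra (prodComonad B) := L ⋙ (coalgebraEquivOver B).inverse
  have h1 : (L' ⋙ Comonad.forget (prodComonad B)).IsLeftAdjoint := by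
    have e : L ⋙ Over.forget B ≅ L' ⋙ Comonad.forget (prodComonad B) :=
      NatIso.ofComponents (fun X => Iso.refl _) (fun f => by
        dsimp [L']; exact (Category.comp_id _).trans (Category.id_comp _).symm)
    exact Functor.isLeftAdjoint_of_iso e
  have h2 : L'.IsLeftAdjoint := isLeftAdjoint_triangle_lift_comonadic (Comonad.forget (prodComonad B))
  have h3 : (L' ⋙ (coalgebraEquivOver B).functor).IsLeftAdjoint := inferInstance
  have e : L' ⋙ (coalgebraEquivOver B).functor ≅ L :=
    Functor.associator _ _ _ ≪≫ Functor.isoWhiskerLeft L (coalgebraEquivOver B).counitIso ≪≫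
      L.rightUnitor
  exact Functor.isLeftAdjoint_of_iso e
end Lift

variable {C : Type u} [SmallCategory C] (F : C ⥤ Cat.{u, u})

lemma eqToHom_three {D : Type*} [Category D] {a b c z : D} (h1 : a = b) (h2 : b = c) (h3 : c = a)
    (g : a ⟶ z) : eqToHom h1 ≫ eqToHom h2 ≫ eqToHom h3 ≫ g = g := by
  subst h1 h2; simp

lemma eqToHom_cancel {D : Type*} [Category D] {a b c z : D} (h1 : a = b) (h2 : a = c) (h3 : c = b)
    (g g' : b ⟶ z) (h : eqToHom h1 ≫ g = eqToHom h2 ≫ eqToHom h3 ≫ g') : g = g' := by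
  subst h1 h2; simpa using h

lemma conj_id {D : Type*} [Category D] {w v : D} (h : v = w) (g : w ⟶ w) (hg : g = 𝟙 w) :
    eqToHom h ≫ g ≫ eqToHom h.symm = 𝟙 v := by
  subst h hg; simp

lemma pullback_nat {D : Type*} [Category D] [HasPullbacks D] {A A' B E P P' : D} (k : A ⟶ A')
    (g : A ⟶ B) (g' : A' ⟶ B) (p : E ⟶ B) (hk : k ≫ g' = g) (i : P ≅ pullback g p)
    (i' : P' ≅ pullback g' p) (j : P ⟶ P')
    (h1 : (i.hom ≫ pullback.fst g p) ≫ k = j ≫ i'.hom ≫ pullback.fst g' p)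
    (h2 : i.hom ≫ pullback.snd g p = j ≫ i'.hom ≫ pullback.snd g' p) :
    i.hom ≫ ((Over.pullback p).map (Over.homMk k hk : Over.mk g ⟶ Over.mk g')).left =
      j ≫ i'.hom := by
  apply pullback.hom_ext
  · refine Eq.trans ?_ (h1.trans (Category.assoc _ _ _).symm)
    refine (Category.assoc _ _ _).trans (Eq.trans ?_ (Category.assoc _ _ _).symm)
    exact congrArg (fun t => i.hom ≫ t) (pullback.lift_fst _ _ _)
  · refine Eq.trans ?_ (h2.trans (Category.assoc _ _ _).symm)
    refine (Category.assoc _ _ _).trans ?_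
    exact congrArg (fun t => i.hom ≫ t) (pullback.lift_snd _ _ _)

lemma iso_shuffle {D : Type*} [Category D] {P Q P' Q' Y : D} (i : P ≅ Q) (i' : P' ≅ Q')
    (t : Q ⟶ Q') (j : P ⟶ P') (e : P' ⟶ Y) (h : i.hom ≫ t = j ≫ i'.hom) :
    t ≫ i'.inv ≫ e = i.inv ≫ j ≫ e := by
  rw [Iso.eq_inv_comp, ← Category.assoc, h]; simp

/-- Objects of the total category as pairs. -/
abbrev pt (c : C) (x : F.obj c) : Grothendieck F := ⟨c, x⟩

variable {F}

/-- The canonical cocartesian lift. -/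
def tr {a b : C} (f : a ⟶ b) (x : F.obj a) : pt F a x ⟶ pt F b ((F.map f).toFunctor.obj x) :=
  ⟨f, 𝟙 _⟩

/-- Factorization through the canonical cocartesian lift. -/
def fac {a b c : C} (f : a ⟶ b) (f' : b ⟶ c) {x : F.obj a} {z : F.obj c}
    (g : pt F a x ⟶ pt F c z) (hg : g.base = f ≫ f') :
    pt F b ((F.map f).toFunctor.obj x) ⟶ pt F c z :=
  ⟨f', eqToHom (by simp [hg]) ≫ g.fiber⟩

lemma tr_fac {a b c : C} (f : a ⟶ b) (f' : b ⟶ c) {x : F.obj a} {z : F.obj c}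
    (g : pt F a x ⟶ pt F c z) (hg : g.base = f ≫ f') : tr f x ≫ fac f f' g hg = g := by
  refine Grothendieck.ext _ _ hg.symm ?_
  rw [Grothendieck.comp_fiber]
  simp [tr, fac]
  exact eqToHom_three _ _ _ _

lemma tr_base {a b : C} (f : a ⟶ b) (x : F.obj a) : (tr f x).base = f := rfl

lemma fac_base {a b c : C} (f : a ⟶ b) (f' : b ⟶ c) {x : F.obj a} {z : F.obj c}
    (g : pt F a x ⟶ pt F c z) (hg : g.base = f ≫ f') : (fac f f' g hg).base = f' := rfl

lemma tr_cancel {a b c : C} (f : a ⟶ b) {x : F.obj a} {z : F.obj c}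
    (r r' : pt F b ((F.map f).toFunctor.obj x) ⟶ pt F c z) (hr : r.base = r'.base)
    (h : tr f x ≫ r = tr f x ≫ r') : r = r' := by
  obtain ⟨r, k⟩ := r
  obtain ⟨r', k'⟩ := r'
  obtain rfl : r = r' := hr
  have := Grothendieck.congr h
  rw [Grothendieck.comp_fiber, Grothendieck.comp_fiber] at this
  simp [tr] at this
  rw [eqToHom_cancel _ _ _ _ _ this]

variable (F)
variable (Y : Type u) [SmallCategory Y]

/-- Objects: a point `c` of the base and a functor from the fiber over `c` to `Y`. -/
structure Sec where
  base : C
  obj : F.obj base → Y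
  map : ∀ {x x' : F.obj base} (g : pt F base x ⟶ pt F base x') (_ : g.base = 𝟙 base),
    obj x ⟶ obj x'
  map_id : ∀ (x : F.obj base) (h), map (𝟙 (pt F base x)) h = 𝟙 _
  map_comp : ∀ {x y z : F.obj base} (g : pt F base x ⟶ pt F base y)
    (g' : pt F base y ⟶ pt F base z) (h h' h''), map (g ≫ g') h'' = map g h ≫ map g' h'

variable {F Y}

/-- Morphisms: an arrow of the base and an action on the arrows of the total category over it. -/
structure SecHom (A B : Sec F Y) where
  base : A.base ⟶ B.base
  app : ∀ {x : F.obj A.base} {y : F.obj B.base} (g : pt F _ x ⟶ pt F _ y) (_ : g.base = base),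
    A.obj x ⟶ B.obj y
  left : ∀ {x x' : F.obj A.base} {y : F.obj B.base} (k : pt F _ x ⟶ pt F _ x')
    (g : pt F _ x' ⟶ pt F _ y) (h h' h''), app (k ≫ g) h'' = A.map k h ≫ app g h'
  right : ∀ {x : F.obj A.base} {y y' : F.obj B.base} (g : pt F _ x ⟶ pt F _ y)
    (k : pt F _ y ⟶ pt F _ y') (h h' h''), app (g ≫ k) h'' = app g h ≫ B.map k h'

lemma SecHom.ext' {A B : Sec F Y} (f g : SecHom A B) (h : f.base = g.base)
    (h' : ∀ x y (k : pt F _ x ⟶ pt F _ y) (e e'), f.app k e = g.app k e') : f = g := by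
  obtain ⟨f, a, _⟩ := f
  obtain ⟨g, b, _⟩ := g
  obtain rfl : f = g := h
  obtain rfl : @a = @b := by funext x y k e; exact h' x y k e e
  rfl

lemma SecHom.heq {A A' B B' : Sec F Y} (hA : A = A') (hB : B = B') (f : SecHom A B)
    (g : SecHom A' B') (h : HEq f.base g.base)
    (h' : HEq (@SecHom.app _ _ _ _ _ _ _ f) (@SecHom.app _ _ _ _ _ _ _ g)) : HEq f g := by
  subst hA hB
  obtain ⟨f, a, _⟩ := f
  obtain ⟨g, b, _⟩ := g
  obtain rfl : f = g := eq_of_heq h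
  obtain rfl : @a = @b := eq_of_heq h'
  rfl

/-- Identity. -/
def secId (A : Sec F Y) : SecHom A A where
  base := 𝟙 _
  app g h := A.map g h
  left k g h h' h'' := A.map_comp _ _ _ _ _
  right k g h h' h'' := A.map_comp _ _ _ _ _

lemma comp_aux {A B D : Sec F Y} (f : SecHom A B) (g : SecHom B D)
    {x : F.obj A.base} {y : F.obj B.base} {z : F.obj D.base}
    (k : pt F _ x ⟶ pt F _ y) (l : pt F _ y ⟶ pt F _ z) (hk : k.base = f.base)
    (hl : l.base = g.base) (n : pt F _ x ⟶ pt F _ z) (hn : k ≫ l = n)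
    (h : n.base = f.base ≫ g.base) :
    f.app (tr f.base x) (tr_base _ _) ≫ g.app (fac f.base g.base n h) (fac_base _ _ _ _) =
      f.app k hk ≫ g.app l hl := by
  subst hn
  have hk' : k.base = f.base ≫ 𝟙 _ := by simp [hk]
  obtain ⟨m, hm, hmb⟩ : ∃ m, tr f.base x ≫ m = k ∧ m.base = 𝟙 _ :=
    ⟨fac f.base (𝟙 _) k hk', tr_fac _ _ _ _, rfl⟩
  have e : fac f.base g.base (k ≫ l) h = m ≫ l := by
    refine tr_cancel _ _ _ ?_ ?_
    · rw [Grothendieck.comp_base, hmb, hl]; exact (Category.id_comp _).symm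
    · rw [tr_fac, ← Category.assoc, hm]
  subst hm
  rw [f.right _ _ (tr_base _ _) hmb]
  refine Eq.trans ?_ (Category.assoc _ _ _).symm
  rw [← g.left m l hmb hl (by rw [← e]; rfl)]
  congr 2

/-- Composition. -/
def secComp {A B D : Sec F Y} (f : SecHom A B) (g : SecHom B D) : SecHom A D where
  base := f.base ≫ g.base
  app {x z} k h := f.app (tr f.base x) (tr_base _ _) ≫
    g.app (fac f.base g.base k h) (fac_base _ _ _ _)
  left {x x' y} k l h h' h'' := by
    have h3 : (k ≫ tr f.base x').base = f.base := by
      rw [Grothendieck.comp_base, h]; exact Category.id_comp _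
    rw [comp_aux f g (k ≫ tr f.base x') (fac f.base g.base l h') h3 (fac_base _ _ _ _) (k ≫ l)
      (by rw [Category.assoc, tr_fac]) h'', f.left k (tr f.base x') h (tr_base _ _), Category.assoc]
  right {x y y'} l k h h' h'' := by
    have h3 : (fac f.base g.base l h ≫ k).base = g.base := by
      rw [Grothendieck.comp_base, h']; exact Category.comp_id _
    rw [comp_aux f g (tr f.base x) (fac f.base g.base l h ≫ k) (tr_base _ _) h3 (l ≫ k)
      (by rw [← Category.assoc, tr_fac]) h'', g.right _ k (fac_base _ _ _ _) h', Category.assoc]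

lemma secComp_app {A B D : Sec F Y} (f : SecHom A B) (g : SecHom B D)
    {x : F.obj A.base} {y : F.obj B.base} {z : F.obj D.base}
    (k : pt F _ x ⟶ pt F _ y) (l : pt F _ y ⟶ pt F _ z) (hk : k.base = f.base)
    (hl : l.base = g.base) (n : pt F _ x ⟶ pt F _ z) (hn : k ≫ l = n)
    (h : n.base = (secComp f g).base) :
    (secComp f g).app n h = f.app k hk ≫ g.app l hl := comp_aux f g k l hk hl n hn h

instance : Category (Sec F Y) where
  Hom := SecHom
  id := secId
  comp := secComp
  id_comp {A B} f := SecHom.ext' _ _ (Category.id_comp _) (fun x y k e e' => by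
    rw [secComp_app (secId A) f (𝟙 _) k rfl e' k (Category.id_comp k) e]
    refine Eq.trans ?_ (Category.id_comp _)
    congr 1
    exact A.map_id _ _)
  comp_id {A B} f := SecHom.ext' _ _ (Category.comp_id _) (fun x y k e e' => by
    rw [secComp_app f (secId B) k (𝟙 _) e' rfl k (Category.comp_id k) e]
    refine Eq.trans ?_ (Category.comp_id _)
    congr 1
    exact B.map_id _ _)
  assoc {A B D E} f g h := SecHom.ext' _ _ (Category.assoc _ _ _) (fun x y k e e' => by
    obtain ⟨r, e1, hrb⟩ : ∃ r, tr f.base x ≫ r = k ∧ r.base = (secComp g h).base :=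
      ⟨fac f.base (g.base ≫ h.base) k e', tr_fac _ _ _ _, rfl⟩
    obtain ⟨s, e2, hsb⟩ : ∃ s, tr g.base _ ≫ s = r ∧ s.base = h.base :=
      ⟨fac g.base h.base r hrb, tr_fac _ _ _ _, rfl⟩
    have h2 : (tr f.base x ≫ tr g.base _).base = (secComp f g).base := rfl
    rw [secComp_app f (secComp g h) (tr f.base x) r (tr_base _ _) hrb k e1 e',
      secComp_app g h _ s (tr_base _ _) hsb r e2,
      secComp_app (secComp f g) h (tr f.base x ≫ tr g.base _) s h2 hsb k
        (by rw [Category.assoc, e2, e1]),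
      secComp_app f g _ _ (tr_base _ _) (tr_base _ _) _ rfl, Category.assoc])

lemma comp_app {A B D : Sec F Y} (f : A ⟶ B) (g : B ⟶ D)
    {x : F.obj A.base} {y : F.obj B.base} {z : F.obj D.base}
    (k : pt F _ x ⟶ pt F _ y) (l : pt F _ y ⟶ pt F _ z) (hk : k.base = SecHom.base f)
    (hl : l.base = SecHom.base g) (h : (k ≫ l).base = SecHom.base f ≫ SecHom.base g) :
    SecHom.app (f ≫ g) (k ≫ l) h = SecHom.app f k hk ≫ SecHom.app g l hl :=
  comp_aux f g k l hk hl _ rfl h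

lemma id_app (A : Sec F Y) {x y : F.obj A.base} (k : pt F _ x ⟶ pt F _ y) (hk) :
    SecHom.app (𝟙 A) k hk = A.map k hk := rfl

variable (F Y) in
/-- Projection to the base. -/
def proj : Sec F Y ⥤ C where
  obj A := A.base
  map f := SecHom.base f

variable {X : Type u} [SmallCategory X] {X' : Type u} [SmallCategory X']

/-- The explicit pullback of the total category of `F` along `G`. -/
structure Pb (G : X ⥤ C) (F : C ⥤ Cat.{u, u}) where
  base : X
  fiber : F.obj (G.obj base)

/-- Morphisms of the explicit pullback. -/
@[ext]
structure PbHom {G : X ⥤ C} (Z W : Pb G F) where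
  fst : Z.base ⟶ W.base
  snd : pt F _ Z.fiber ⟶ pt F _ W.fiber
  w : snd.base = G.map fst

instance (G : X ⥤ C) : Category (Pb G F) where
  Hom := PbHom
  id Z := ⟨𝟙 _, 𝟙 _, (G.map_id _).symm⟩
  comp f g := ⟨f.fst ≫ g.fst, f.snd ≫ g.snd, by
    rw [Grothendieck.comp_base, f.w, g.w]; exact (G.map_comp _ _).symm⟩
  id_comp f := PbHom.ext (Category.id_comp _) (Category.id_comp _)
  comp_id f := PbHom.ext (Category.comp_id _) (Category.comp_id _)
  assoc f g h := PbHom.ext (Category.assoc _ _ _) (Category.assoc _ _ _)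

/-- First projection. -/
def pfst (G : X ⥤ C) (F : C ⥤ Cat.{u, u}) : Pb G F ⥤ X where
  obj Z := Z.base
  map f := PbHom.fst f

/-- Second projection. -/
def psnd (G : X ⥤ C) (F : C ⥤ Cat.{u, u}) : Pb G F ⥤ Grothendieck F where
  obj Z := pt F _ Z.fiber
  map f := PbHom.snd f

/-- Functoriality of the explicit pullback. -/
def pre (K : X ⥤ X') (G : X' ⥤ C) (F : C ⥤ Cat.{u, u}) : Pb (K ⋙ G) F ⥤ Pb G F where
  obj Z := ⟨K.obj Z.base, Z.fiber⟩
  map {Z W} f := ⟨K.map (PbHom.fst f), @PbHom.snd _ _ _ _ _ _ Z W f, @PbHom.w _ _ _ _ _ _ Z W f⟩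
  map_id Z := PbHom.ext (K.map_id _) rfl
  map_comp f g := PbHom.ext (K.map_comp _ _) rfl

variable (F Y) in
/-- Evaluation. -/
def ev : Pb (proj F Y) F ⥤ Y where
  obj Z := Z.base.obj Z.fiber
  map {Z W} k := SecHom.app (PbHom.fst k) (PbHom.snd k) (PbHom.w k)
  map_id Z := Z.base.map_id _ _
  map_comp {Z W V} k l := comp_app _ _ _ _ _ _ _

/-- Transposition on objects. -/
def curryObj (G : X ⥤ C) (φ : Pb G F ⥤ Y) (x : X) : Sec F Y where
  base := G.obj x
  obj := fun y => φ.obj ⟨x, y⟩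
  map := fun {y y'} g h => φ.map (X := ⟨x, y⟩) (Y := ⟨x, y'⟩)
    ⟨𝟙 x, g, h.trans (G.map_id _).symm⟩
  map_id := fun y h => φ.map_id ⟨x, y⟩
  map_comp := fun {a b c} g g' h h' h'' => by
    rw [← φ.map_comp]
    congr 1
    exact PbHom.ext (Category.id_comp _).symm rfl

/-- Transposition on morphisms. -/
def curryMap (G : X ⥤ C) (φ : Pb G F ⥤ Y) {x x' : X} (f : x ⟶ x') :
    SecHom (curryObj G φ x) (curryObj G φ x') where
  base := G.map f
  app := fun {y y'} g h => φ.map (X := ⟨x, y⟩) (Y := ⟨x', y'⟩) ⟨f, g, h⟩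
  left := fun {a b c} g g' h h' h'' => by
    refine Eq.trans ?_ (φ.map_comp _ _)
    congr 1
    exact PbHom.ext (Category.id_comp _).symm rfl
  right := fun {a b c} g g' h h' h'' => by
    refine Eq.trans ?_ (φ.map_comp _ _)
    congr 1
    exact PbHom.ext (Category.comp_id _).symm rfl

/-- Transposition. -/
def curry (G : X ⥤ C) (φ : Pb G F ⥤ Y) : X ⥤ Sec F Y where
  obj x := curryObj G φ x
  map {x x'} f := curryMap G φ f
  map_id x := SecHom.ext' _ _ (G.map_id _) (fun y y' k e e' => rfl)
  map_comp {x y z} f g := SecHom.ext' _ _ (G.map_comp _ _) (fun a c k e e' => by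
    obtain ⟨r, e1, hrb⟩ : ∃ r, tr (G.map f) a ≫ r = k ∧ r.base = G.map g :=
      ⟨fac (G.map f) (G.map g) k e', tr_fac _ _ _ _, rfl⟩
    subst e1
    refine Eq.trans ?_ (secComp_app (curryMap G φ f) (curryMap G φ g) (tr (G.map f) a) r rfl hrb
      _ rfl e').symm
    refine Eq.trans ?_ (φ.map_comp _ _)
    rfl)

lemma pre_curry_ev (G : X ⥤ C) (φ : Pb G F ⥤ Y) :
    pre (curry G φ) (proj F Y) F ⋙ ev F Y = φ := rfl

lemma curry_pre_ev (K : X ⥤ Sec F Y) :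
    curry (K ⋙ proj F Y) (pre K (proj F Y) F ⋙ ev F Y) = K := by
  have hobj : ∀ x, (curry (K ⋙ proj F Y) (pre K (proj F Y) F ⋙ ev F Y)).obj x = K.obj x := by
    intro x
    have : ∀ (A : Sec F Y) (f : A ⟶ A) (hf : f = 𝟙 A) (r : SecHom.base f = 𝟙 _) (p q),
      (⟨A.base, A.obj, fun g h => SecHom.app f g (h.trans r.symm), p, q⟩ : Sec F Y) = A := by
      rintro A f rfl r p q
      rfl
    exact this (K.obj x) (K.map (𝟙 x)) (K.map_id x) (congrArg SecHom.base (K.map_id x)) _ _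
  refine CategoryTheory.Functor.hext hobj ?_
  intro x y f
  exact SecHom.heq (hobj x) (hobj y) _ _ HEq.rfl HEq.rfl

section Pullback
variable {Z : Type u} [SmallCategory Z]

/-- Transport of a point to an equal base. -/
def castPt (w : Grothendieck F) (c : C) (h : w.base = c) : F.obj c := h ▸ w.fiber

lemma castPt_eq (w : Grothendieck F) (c : C) (h : w.base = c) : pt F c (castPt w c h) = w := by
  subst h; rfl

lemma lift_aux {w w' v v' : Grothendieck F} (h : v = w) (h' : w' = v') (g : w ⟶ w') :
    (eqToHom h ≫ g ≫ eqToHom h').base =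
      eqToHom (by rw [h]) ≫ g.base ≫ eqToHom (by rw [h']) := by
  subst h h'; simp

/-- The universal functor. -/
def liftF {G : X ⥤ C} (a : Z ⥤ X) (b : Z ⥤ Grothendieck F)
    (h : a ⋙ G = b ⋙ Grothendieck.forget F) : Z ⥤ Pb G F where
  obj z := ⟨a.obj z, castPt (b.obj z) (G.obj (a.obj z)) (Functor.congr_obj h z).symm⟩
  map {z z'} f := ⟨a.map f, eqToHom (castPt_eq _ _ _) ≫ b.map f ≫ eqToHom (castPt_eq _ _ _).symm, by
    rw [lift_aux]
    exact (Functor.congr_hom h f).symm⟩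
  map_id z := PbHom.ext (a.map_id _) (conj_id _ _ (b.map_id z))
  map_comp f g := PbHom.ext (a.map_comp _ _) (by
    refine Eq.trans ?_ (Category.assoc _ _ _).symm
    simp)

lemma liftF_psnd {G : X ⥤ C} (a : Z ⥤ X) (b : Z ⥤ Grothendieck F)
    (h : a ⋙ G = b ⋙ Grothendieck.forget F) : liftF a b h ⋙ psnd G F = b :=
  CategoryTheory.Functor.ext (fun z => castPt_eq _ _ _) (fun _ _ _ => rfl)

lemma Pb.ext' {G : X ⥤ C} (A B : Pb G F) (h : A.base = B.base)
    (h' : pt F _ A.fiber = pt F _ B.fiber) : A = B := by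
  obtain ⟨a, x⟩ := A
  obtain ⟨b, y⟩ := B
  obtain rfl : a = b := h
  have : x = y := eq_of_heq (Grothendieck.mk.inj h').2
  rw [this]

lemma PbHom.heq {G : X ⥤ C} {A A' B B' : Pb G F} (hA : A = A') (hB : B = B') (f : PbHom A B)
    (g : PbHom A' B') (h : HEq f.fst g.fst) (h' : HEq f.snd g.snd) : HEq f g := by
  subst hA hB
  exact heq_of_eq (PbHom.ext (eq_of_heq h) (eq_of_heq h'))

lemma functor_ext {G : X ⥤ C} (m m' : Z ⥤ Pb G F) (h1 : m ⋙ pfst G F = m' ⋙ pfst G F)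
    (h2 : m ⋙ psnd G F = m' ⋙ psnd G F) : m = m' := by
  have ho : ∀ z, m.obj z = m'.obj z := fun z =>
    Pb.ext' _ _ (Functor.congr_obj h1 z) (Functor.congr_obj h2 z)
  refine CategoryTheory.Functor.hext ho (fun z z' f => PbHom.heq (ho z) (ho z') _ _ ?_ ?_)
  · exact Functor.hcongr_hom h1 f
  · exact Functor.hcongr_hom h2 f

lemma isPb (G : X ⥤ C) (F : C ⥤ Cat.{u, u}) :
    IsPullback (pfst G F).toCatHom (psnd G F).toCatHom G.toCatHom
      (Grothendieck.forget F).toCatHom := by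
  have w : pfst G F ⋙ G = psnd G F ⋙ Grothendieck.forget F :=
    CategoryTheory.Functor.hext (fun _ => rfl) (fun _ _ f => heq_of_eq (PbHom.w f).symm)
  refine ⟨⟨congrArg Functor.toCatHom w⟩, ⟨PullbackCone.IsLimit.mk _
    (fun s => (liftF (X := X) (G := G) s.fst.toFunctor s.snd.toFunctor
      (congrArg Cat.Hom.toFunctor s.condition)).toCatHom) ?_ ?_ ?_⟩⟩
  · intro s
    exact Cat.ext rfl
  · intro s
    exact Cat.ext (liftF_psnd (X := X) (G := G) s.fst.toFunctor s.snd.toFunctor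
      (congrArg Cat.Hom.toFunctor s.condition))
  · intro s m h1 h2
    refine Cat.ext (functor_ext _ _ ?_ ?_)
    · exact congrArg Cat.Hom.toFunctor h1
    · exact (congrArg Cat.Hom.toFunctor h2).trans (liftF_psnd (X := X) (G := G) s.fst.toFunctor
        s.snd.toFunctor (congrArg Cat.Hom.toFunctor s.condition)).symm

end Pullback

section Final

variable (F) in
/-- The projection as a morphism of `Cat`. -/
abbrev pr : Cat.of (Grothendieck F) ⟶ Cat.of C := (Grothendieck.forget F).toCatHom

variable (F) in
/-- Identification of the pullback. -/
noncomputable def iso (G : X ⥤ C) : Cat.of (Pb G F) ≅ pullback G.toCatHom (pr F) :=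
  (isPb G F).isoPullback

lemma iso_hom_fst (G : X ⥤ C) :
    (iso F G).hom ≫ pullback.fst G.toCatHom (pr F) = (pfst G F).toCatHom :=
  (isPb G F).isoPullback_hom_fst

lemma iso_hom_snd (G : X ⥤ C) :
    (iso F G).hom ≫ pullback.snd G.toCatHom (pr F) = (psnd G F).toCatHom :=
  (isPb G F).isoPullback_hom_snd

/-- A functor over the base. -/
abbrev ovHom (K : X ⥤ X') (G : X' ⥤ C) :
    (Over.mk (K ⋙ G).toCatHom : Over (Cat.of C)) ⟶ Over.mk G.toCatHom :=
  Over.homMk K.toCatHom rfl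

lemma iso_nat (K : X ⥤ X') (G : X' ⥤ C) :
    (iso F (K ⋙ G)).hom ≫ ((Over.pullback (pr F)).map (ovHom K G)).left =
      (pre K G F).toCatHom ≫ (iso F G).hom := by
  refine pullback_nat K.toCatHom (K ⋙ G).toCatHom G.toCatHom (pr F) rfl (iso F (K ⋙ G)) (iso F G)
    (pre K G F).toCatHom ?_ ?_
  · exact (congrArg (fun t => t ≫ K.toCatHom) (iso_hom_fst (K ⋙ G))).trans
      (congrArg (fun t => (pre K G F).toCatHom ≫ t) (iso_hom_fst G)).symm
  · exact (iso_hom_snd (K ⋙ G)).trans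
      (congrArg (fun t => (pre K G F).toCatHom ≫ t) (iso_hom_snd G)).symm

/-- The value of the right adjoint. -/
abbrev R (F : C ⥤ Cat.{u, u}) (Y : Cat.{u, u}) : Over (Cat.of C) := Over.mk (proj F Y).toCatHom

/-- The counit. -/
noncomputable def counit (F : C ⥤ Cat.{u, u}) (Y : Cat.{u, u}) :
    ((Over.pullback (pr F)).obj (R F Y)).left ⟶ Y :=
  (iso F (proj F Y)).inv ≫ (ev F Y).toCatHom

lemma map_counit (Y : Cat.{u, u}) (K : X ⥤ Sec F Y) :
    ((Over.pullback (pr F)).map (ovHom K (proj F Y))).left ≫ counit F Y =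
      (iso F (K ⋙ proj F Y)).inv ≫ (pre K (proj F Y) F ⋙ ev F Y).toCatHom := by
  exact iso_shuffle (iso F (K ⋙ proj F Y)) (iso F (proj F Y)) _ (pre K (proj F Y) F).toCatHom
    (ev F Y).toCatHom (iso_nat K (proj F Y))

lemma counit_surj (Y : Cat.{u, u}) (G : X ⥤ C)
    (φ : ((Over.pullback (pr F)).obj (Over.mk G.toCatHom)).left ⟶ Y) :
    ∃ k : Over.mk G.toCatHom ⟶ R F Y, ((Over.pullback (pr F)).map k).left ≫ counit F Y = φ := by
  refine ⟨ovHom (curry G ((iso F G).hom ≫ φ).toFunctor) (proj F Y), ?_⟩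
  refine (map_counit Y (curry G ((iso F G).hom ≫ φ).toFunctor)).trans ?_
  exact (Iso.inv_comp_eq (iso F G)).2 rfl

lemma counit_left_inv (Y : Cat.{u, u}) (G : X ⥤ C) (K : X ⥤ Sec F Y) (h : K ⋙ proj F Y = G)
    (k : Over.mk G.toCatHom ⟶ R F Y) (hk : k.left = K.toCatHom) :
    curry G ((iso F G).hom ≫ ((Over.pullback (pr F)).map k).left ≫ counit F Y).toFunctor = K := by
  subst h
  obtain rfl : k = ovHom K (proj F Y) := Over.OverMorphism.ext hk
  have := (Iso.eq_inv_comp (iso F (K ⋙ proj F Y))).1 (map_counit Y K)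
  exact (congrArg (fun t => curry (K ⋙ proj F Y) (Cat.Hom.toFunctor t)) this).trans (curry_pre_ev K)

lemma counit_inj (Y : Cat.{u, u}) (G : X ⥤ C) (k k' : Over.mk G.toCatHom ⟶ R F Y)
    (h : ((Over.pullback (pr F)).map k).left ≫ counit F Y =
      ((Over.pullback (pr F)).map k').left ≫ counit F Y) : k = k' := by
  have h1 := counit_left_inv Y G k.left.toFunctor (congrArg Cat.Hom.toFunctor (Over.w k)) k rfl
  have h2 := counit_left_inv Y G k'.left.toFunctor (congrArg Cat.Hom.toFunctor (Over.w k')) k' rfl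
  rw [h] at h1
  exact Over.OverMorphism.ext (Cat.ext (h1.symm.trans h2))

lemma counit_bij (Y : Cat.{u, u}) (Z : Over (Cat.of C)) :
    Function.Bijective (fun k : Z ⟶ R F Y =>
      (Over.pullback (pr F) ⋙ Over.forget _).map k ≫ counit F Y) :=
  ⟨fun k k' h => counit_inj (X := Z.left) Y Z.hom.toFunctor k k' h,
    fun φ => counit_surj (X := Z.left) Y Z.hom.toFunctor φ⟩

theorem main (F : C ⥤ Cat.{u, u}) : (Over.pullback (pr F)).IsLeftAdjoint := by
  have : HasEqualizers (Over (Cat.of C)) :=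
    hasEqualizers_of_hasPullbacks_and_binary_products
  apply isLeftAdjoint_of_comp_forget
  exact (Adjunction.adjunctionOfEquivRight (G_obj := R F)
    (fun Z Y => (Equiv.ofBijective _ (counit_bij Y Z)).symm) (fun Z' Z Y f g => by
      rw [Equiv.symm_apply_eq]
      obtain ⟨k, rfl⟩ := (Equiv.ofBijective _ (counit_bij Y Z)).surjective g
      rw [Equiv.symm_apply_apply]
      simp only [Equiv.ofBijective_apply, Functor.map_comp]
      exact (Category.assoc _ _ _).symm)).isLeftAdjoint

end Final

end GrothExp

/-- For a small category `C` and a functor `F : C ⥤ Cat`, the base-change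
functor along the projection `Grothendieck.forget F : Grothendieck F ⥤ C`,
i.e. the pullback functor `Over (Cat.of C) ⥤ Over (Cat.of (Grothendieck F))` in
`Cat`, admits a right adjoint; in particular it preserves all small colimits. -/
theorem over_pullback_grothendieck_forget_isLeftAdjoint {C : Type u} [SmallCategory C]
    (F : C ⥤ Cat.{u, u}) :
    (Over.pullback
        (show Cat.of (Grothendieck F) ⟶ Cat.of C from (Grothendieck.forget F).toCatHom)).IsLeftAdjoint ∧
      Nonempty (PreservesColimits (Over.pullback
        (show Cat.of (Grothendieck F) ⟶ Cat.of C from (Grothendieck.forget F).toCatHom))) := by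
  have h := GrothExp.main F
  refine ⟨h, ⟨?_⟩⟩
  exact (Adjunction.ofIsLeftAdjoint (Over.pullback (GrothExp.pr F))).leftAdjoint_preservesColimits
end
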